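/- Every path on n vertices with all edge labels in {U,D} admits a planar direction-consistent embedding on every set of n points in convex position in general position. -/

import Mathlib

/-- Edge direction labels. -/
inductive Dir | U | D | L | R
deriving DecidableEq

/-- Opposite label: U↔D, L↔R. -/
def Dir.opp : Dir → Dir
  | .U => .D | .D => .U | .L => .R | .R => .L

/-- Label after counterclockwise rotation by π/2: U↦L, D↦R, R↦U, L↦D. -/
def Dir.rot : Dir → Dir
  | .U => .L | .D => .R | .R => .U | .L => .D

/-- Label after vertical-line reflection: U↦U, D↦D, R↦L, L↦R. -/
def Dir.mir : Dir → Dir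
  | .U => .U | .D => .D | .R => .L | .L => .R

/-- An edge from `a` to `b` is consistent with a direction label. -/
def dirOk : Dir → ℝ × ℝ → ℝ × ℝ → Prop
  | .U, a, b => a.2 < b.2
  | .D, a, b => b.2 < a.2
  | .R, a, b => a.1 < b.1
  | .L, a, b => b.1 < a.1

/-- The drawing of a path with edge labels `d` and vertex placement `E` is
direction-consistent. -/
def DirConsistent {m : ℕ} (d : Fin m → Dir) (E : Fin (m + 1) → ℝ × ℝ) : Prop :=
  ∀ i : Fin m, dirOk (d i) (E i.castSucc) (E i.succ)

/-- The straight-line drawing of the path with vertex placement `E` is planar: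
non-adjacent segments are disjoint; adjacent segments meet only at the shared endpoint. -/
def PlanarDrawing {m : ℕ} (E : Fin (m + 1) → ℝ × ℝ) : Prop :=
  (∀ i j : Fin m, (i : ℕ) + 1 < (j : ℕ) →
    segment ℝ (E i.castSucc) (E i.succ) ∩ segment ℝ (E j.castSucc) (E j.succ) = ∅) ∧
  (∀ i j : Fin m, (i : ℕ) + 1 = (j : ℕ) →
    segment ℝ (E i.castSucc) (E i.succ) ∩ segment ℝ (E j.castSucc) (E j.succ) = {E i.succ})

/-- `E` is an embedding of the path vertices onto the point set `S`. -/
def EmbOn {m : ℕ} (E : Fin (m + 1) → ℝ × ℝ) (S : Set (ℝ × ℝ)) : Prop :=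
  Function.Injective E ∧ Set.range E = S

/-- Planar direction-consistent embedding of the labeled path `d` on `S`. -/
def PDCE {m : ℕ} (d : Fin m → Dir) (E : Fin (m + 1) → ℝ × ℝ) (S : Set (ℝ × ℝ)) : Prop :=
  EmbOn E S ∧ DirConsistent d E ∧ PlanarDrawing E

/-- `S` is in convex position. -/
def ConvexPos (S : Set (ℝ × ℝ)) : Prop :=
  ConvexIndependent ℝ ((↑) : S → ℝ × ℝ)

/-- No three distinct points of `S` are collinear. -/
def NoThreeCollinear (S : Set (ℝ × ℝ)) : Prop :=
  ∀ p ∈ S, ∀ q ∈ S, ∀ r ∈ S, p ≠ q → p ≠ r → q ≠ r →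
    ¬ Collinear ℝ ({p, q, r} : Set (ℝ × ℝ))

/-- General position: no three collinear, no two points with equal x- or y-coordinate. -/
def GenPos (S : Set (ℝ × ℝ)) : Prop :=
  NoThreeCollinear S ∧ ∀ p ∈ S, ∀ q ∈ S, p ≠ q → p.1 ≠ q.1 ∧ p.2 ≠ q.2

def IsTopmost (S : Set (ℝ × ℝ)) (t : ℝ × ℝ) : Prop :=
  t ∈ S ∧ ∀ p ∈ S, p ≠ t → p.2 < t.2
def IsBottommost (S : Set (ℝ × ℝ)) (b : ℝ × ℝ) : Prop :=
  b ∈ S ∧ ∀ p ∈ S, p ≠ b → b.2 < p.2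
def IsLeftmost (S : Set (ℝ × ℝ)) (l : ℝ × ℝ) : Prop :=
  l ∈ S ∧ ∀ p ∈ S, p ≠ l → l.1 < p.1
def IsRightmost (S : Set (ℝ × ℝ)) (r : ℝ × ℝ) : Prop :=
  r ∈ S ∧ ∀ p ∈ S, p ≠ r → p.1 < r.1

/-- Cross product telling on which side of the directed line `a → b` the point `p` lies
(`0 < cross a b p` means `p` is strictly to the left). -/
def cross (a b p : ℝ × ℝ) : ℝ :=
  (b.1 - a.1) * (p.2 - a.2) - (b.2 - a.2) * (p.1 - a.1)

/-- With `b` bottommost and `t` topmost, all other points lie strictly to the left of the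
line through `b` and `t`. -/
def LeftSided (S : Set (ℝ × ℝ)) (b t : ℝ × ℝ) : Prop :=
  IsBottommost S b ∧ IsTopmost S t ∧ ∀ p ∈ S, p ≠ b → p ≠ t → 0 < cross b t p

/-- With `b` bottommost and `t` topmost, all other points lie strictly to the right of the
line through `b` and `t`. -/
def RightSided (S : Set (ℝ × ℝ)) (b t : ℝ × ℝ) : Prop :=
  IsBottommost S b ∧ IsTopmost S t ∧ ∀ p ∈ S, p ≠ b → p ≠ t → cross b t p < 0

/-- Two points of `S` are consecutive on the convex hull of `S`: all other points of `S`
lie strictly on one side of the line through them. -/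
def HullConsecutive (S : Set (ℝ × ℝ)) (p q : ℝ × ℝ) : Prop :=
  p ∈ S ∧ q ∈ S ∧ p ≠ q ∧
    ((∀ r ∈ S, r ≠ p → r ≠ q → 0 < cross p q r) ∨
     (∀ r ∈ S, r ≠ p → r ≠ q → cross p q r < 0))

/-- Strip-convex point set with bottommost `b`, leftmost `l`, topmost `t`, rightmost `r`:
`b` and `l` coincide or are hull-consecutive, and so do `t` and `r`. -/
def StripConvex (S : Set (ℝ × ℝ)) (b l t r : ℝ × ℝ) : Prop :=
  IsBottommost S b ∧ IsLeftmost S l ∧ IsTopmost S t ∧ IsRightmost S r ∧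
    (b = l ∨ HullConsecutive S b l) ∧ (t = r ∨ HullConsecutive S t r)

/-- `T` is a consecutive subset of the convex point set `S` along its hull:
it can be separated from `S \ T` by a line. -/
def Consecutive (S T : Set (ℝ × ℝ)) : Prop :=
  T ⊆ S ∧ ∃ f : (ℝ × ℝ) →ₗ[ℝ] ℝ, ∃ c : ℝ,
    (∀ p ∈ T, c < f p) ∧ ∀ p ∈ S \ T, f p < c

/-- `Moves u x y` says that `y` lies above `x` if `u` is true, and below `x` otherwise. -/
def Moves (u : Bool) (x y : ℝ) : Prop := if u then x < y else y < x

/-- `Reach d H k i x`: the cyclic arc `[i, i + k]` can be visited by a sequence ending in `x`, whose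
heights `H` move as prescribed by `d`, such that every prefix of the sequence covers an arc. -/
inductive Reach (d : ℕ → Bool) (H : ℤ → ℝ) : ℕ → ℤ → ℤ → Prop
  | base (i : ℤ) : Reach d H 0 i i
  | left {k : ℕ} {i x : ℤ} : Reach d H k i x → Moves (d k) (H x) (H (i - 1)) →
      Reach d H (k + 1) (i - 1) (i - 1)
  | right {k : ℕ} {i x : ℤ} : Reach d H k i x → Moves (d k) (H x) (H (i + k + 1)) →
      Reach d H (k + 1) i (i + k + 1)

namespace Reach

variable {d : ℕ → Bool} {H : ℤ → ℝ}

theorem reflect {τ : ℤ} {k : ℕ} {i x : ℤ}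
    (h : Reach (fun k => !d k) (fun i => -H (τ - i)) k i x) :
    Reach d H k (τ - i - k) (τ - x) := by
  induction h with
  | base i => simpa using Reach.base (d := d) (H := H) (τ - i)
  | @left k i x _ hm ih =>
    have := ih.right (by
      rw [show τ - i - (k : ℤ) + k + 1 = τ - (i - 1) by ring]
      revert hm; cases hd : d k <;> simp [Moves])
    convert this using 1 <;> push_cast <;> ring
  | @right k i x _ hm ih =>
    have := ih.left (by
      rw [show τ - i - (k : ℤ) - 1 = τ - (i + k + 1) by ring]
      revert hm; cases hd : d k <;> simp [Moves])
    convert this using 1 <;> push_cast <;> ring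

theorem exists_sequence {k : ℕ} {i x : ℤ} (h : Reach d H k i x) :
    ∃ (σ lo : ℕ → ℤ), σ k = x ∧ lo k = i ∧
      (∀ l ≤ k, ∀ z, z ∈ Set.Icc (lo l) (lo l + l) ↔ ∃ j ≤ l, σ j = z) ∧
      ∀ l < k, Moves (d l) (H (σ l)) (H (σ (l + 1))) := by
  have extend : ∀ (k : ℕ) (i x i' y : ℤ),
      (∃ (σ lo : ℕ → ℤ), σ k = x ∧ lo k = i ∧
      (∀ l ≤ k, ∀ z, z ∈ Set.Icc (lo l) (lo l + l) ↔ ∃ j ≤ l, σ j = z) ∧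
      ∀ l < k, Moves (d l) (H (σ l)) (H (σ (l + 1)))) →
      Moves (d k) (H x) (H y) →
      (∀ z, z ∈ Set.Icc i' (i' + (k + 1 : ℕ)) ↔ z ∈ Set.Icc i (i + k) ∨ z = y) →
      ∃ (σ lo : ℕ → ℤ), σ (k + 1) = y ∧ lo (k + 1) = i' ∧
      (∀ l ≤ k + 1, ∀ z, z ∈ Set.Icc (lo l) (lo l + l) ↔ ∃ j ≤ l, σ j = z) ∧
      ∀ l < k + 1, Moves (d l) (H (σ l)) (H (σ (l + 1))) := by
    rintro k i x i' y ⟨σ, lo, hσ, hlo, harc, hmov⟩ hm hz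
    refine ⟨fun l => if l ≤ k then σ l else y, fun l => if l ≤ k then lo l else i',
      by simp, by simp, ?_, ?_⟩
    · intro l hl z
      rcases Nat.lt_or_ge k l with hlk | hlk
      · obtain rfl : l = k + 1 := by omega
        have h1 := harc k le_rfl z
        rw [hlo] at h1
        simp only [show ¬ (k + 1 ≤ k) by omega, if_false]
        rw [hz, h1]
        constructor
        · rintro (⟨j, hj, rfl⟩ | rfl)
          · exact ⟨j, by omega, by simp [hj]⟩
          · exact ⟨k + 1, le_rfl, by simp⟩
        · rintro ⟨j, hj, rfl⟩
          by_cases hjk : j ≤ k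
          · exact Or.inl ⟨j, hjk, by simp [hjk]⟩
          · exact Or.inr (by simp [hjk])
      · simp only [hlk, if_true]
        rw [harc l hlk]
        constructor
        · rintro ⟨j, hj, rfl⟩
          exact ⟨j, hj, by simp [hj.trans hlk]⟩
        · rintro ⟨j, hj, rfl⟩
          exact ⟨j, hj, by simp [hj.trans hlk]⟩
    · intro l hl
      rcases Nat.lt_or_ge l k with hlk | hlk
      · simpa [hlk.le, Nat.succ_le_of_lt hlk] using hmov l hlk
      · obtain rfl : l = k := by omega
        simpa [hσ] using hm
  induction h with
  | base i =>
    refine ⟨fun _ => i, fun _ => i, rfl, rfl, ?_, by simp⟩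
    intro l hl z
    obtain rfl : l = 0 := by omega
    simp only [Set.mem_Icc]
    constructor
    · intro h; exact ⟨0, le_rfl, by push_cast at h; omega⟩
    · rintro ⟨_, _, rfl⟩; simp
  | @left k i x _ hm ih =>
    refine extend k i x (i - 1) (i - 1) ih hm fun z => ?_
    simp only [Set.mem_Icc]; push_cast; omega
  | @right k i x _ hm ih =>
    refine extend k i x i (i + k + 1) ih hm fun z => ?_
    simp only [Set.mem_Icc]; push_cast; omega

/-- On a descending chain every prescribed sequence of moves can be realised. -/
theorem exists_of_strictAntiOn {L : ℤ} (hanti : StrictAntiOn H (Set.Icc L 0)) (k : ℕ) :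
    ∀ i : ℤ, L ≤ i → i + k ≤ 0 → ∃ x ∈ Set.Icc i (i + k), Reach d H k i x := by
  induction k with
  | zero => exact fun i _ _ => ⟨i, by simp, .base i⟩
  | succ k ih =>
    intro i hi hk
    push_cast at hk
    cases hd : d k with
    | true =>
      obtain ⟨x, hx, hr⟩ := ih (i + 1) (by omega) (by omega)
      rw [Set.mem_Icc] at hx
      have := hr.left (by
        simp only [Moves, hd, if_true]
        exact hanti (by constructor <;> omega) (by constructor <;> omega) (by omega))
      rw [add_sub_cancel_right] at this
      exact ⟨i, by constructor <;> push_cast <;> omega, this⟩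
    | false =>
      obtain ⟨x, hx, hr⟩ := ih i (by omega) (by omega)
      rw [Set.mem_Icc] at hx
      exact ⟨_, by constructor <;> push_cast <;> omega, hr.right (by
        simp only [Moves, hd]
        exact hanti (by constructor <;> omega) (by constructor <;> omega) (by omega))⟩

/-- A run of upward moves, visiting the remaining points of both chains by increasing height. -/
theorem sweep {L τ J : ℤ} {c : ℕ} (hanti : StrictAntiOn H (Set.Icc L 0))
    (hmono : StrictMonoOn H (Set.Icc 0 τ)) (htop : H L = H τ) (hJ : J < τ) (hc : (c : ℤ) = J - L)
    (hne : ∀ i j, L < i → i < 0 → 0 < j → j < τ → H i ≠ H j) (s : ℕ) :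
    ∀ (k : ℕ) (i x : ℤ), Reach d H k i x → s + k = c → L < i → i ≤ 0 → 0 ≤ i + k → i + k ≤ J →
      H x < H (i - 1) → (i + k < J → H x < H (i + k + 1)) →
      (∀ l, k ≤ l → l < c → d l = true) → Reach d H c L L := by
  induction s with
  | zero => intros; omega
  | succ s ih =>
    intro k i x hr hs hLi hi hj hjJ hxl hxr hd
    have hdk : d k = true := hd k le_rfl (by omega)
    have hd' : ∀ l, k + 1 ≤ l → l < c → d l = true := fun l hl => hd l (by omega)
    have hleft := hr.left (by simpa [Moves, hdk] using hxl)
    rcases lt_or_ge (i + k) J with hlt | hge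
    · rcases lt_or_ge (H (i + k + 1)) (H (i - 1)) with hlow | hlow
      · refine ih (k + 1) i _ (hr.right (by simpa [Moves, hdk] using hxr hlt)) (by omega) hLi hi
          (by push_cast; omega) (by push_cast; omega) hlow ?_ hd'
        intro h
        push_cast at h ⊢
        exact hmono (by constructor <;> omega) (by constructor <;> omega) (by omega)
      · have hiL : L < i - 1 := by
          by_contra hcon
          obtain h : i - 1 = L := by omega
          rw [h, htop] at hlow
          exact absurd (hmono (a := i + k + 1) (b := τ) (by constructor <;> omega)
            (by constructor <;> omega) (by omega)) (not_lt.2 hlow)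
        refine ih (k + 1) (i - 1) _ hleft (by omega) hiL (by omega)
          (by push_cast; omega) (by push_cast; omega) ?_ ?_ hd'
        · exact hanti (by constructor <;> omega) (by constructor <;> omega) (by omega)
        · intro _
          push_cast
          rw [show i - 1 + ((k : ℤ) + 1) + 1 = i + k + 1 by ring]
          exact lt_of_le_of_ne hlow (hne _ _ hiL (by omega) (by omega) (by omega))
    · rcases eq_or_lt_of_le (show L ≤ i - 1 by omega) with h | h
      · rw [← h] at hleft
        rwa [show k + 1 = c by omega] at hleft
      · refine ih (k + 1) (i - 1) _ hleft (by omega) h (by omega)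
          (by push_cast; omega) (by push_cast; omega) ?_ ?_ hd'
        · exact hanti (by constructor <;> omega) (by constructor <;> omega) (by omega)
        · intro hlt
          push_cast at hlt
          omega

/-- When the unvisited points form a single chain, every sequence of moves can be completed. -/
theorem complete {n τ : ℤ} {m : ℕ} (hn : n = m + 1) (hper : ∀ i, H (i + n) = H i)
    (hmono : StrictMonoOn H (Set.Icc 0 τ)) (s : ℕ) :
    ∀ (k : ℕ) (i x : ℤ), Reach d H k i x → s + k = m → i + n ≤ τ → 0 ≤ i + k →
      (∀ z, i + k < z → z < i + n → Moves (d k) (H x) (H z)) → ∃ i x, Reach d H m i x := by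
  induction s with
  | zero =>
    intro k i x hr hs _ _ _
    obtain rfl : k = m := by omega
    exact ⟨i, x, hr⟩
  | succ s ih =>
    intro k i x hr hs hi hj hx
    cases hd : d (k + 1) with
    | true =>
      refine ih (k + 1) i _ (hr.right (hx _ (by omega) (by omega))) (by omega) hi
        (by push_cast; omega) ?_
      intro z hz hz'
      push_cast at hz
      simp only [Moves, hd, if_true]
      exact hmono (by constructor <;> omega) (by constructor <;> omega) (by omega)
    | false =>
      have h : H (i - 1 + n) = H (i - 1) := hper (i - 1)
      refine ih (k + 1) (i - 1) _ (hr.left (h ▸ hx _ (by omega) (by omega))) (by omega) (by omega)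
        (by push_cast; omega) ?_
      intro z hz hz'
      push_cast at hz
      simp only [Moves, hd, ← h]
      exact hmono (by constructor <;> omega) (by constructor <;> omega) (by omega)

theorem exists_run_start (l : ℕ) (h : d l = true) :
    ∃ a ≤ l, (∀ k, a ≤ k → k ≤ l → d k = true) ∧ (a = 0 ∨ ∃ a', a = a' + 1 ∧ d a' = false) := by
  induction l with
  | zero => exact ⟨0, le_rfl, fun k _ hk => by rwa [Nat.le_zero.1 hk], Or.inl rfl⟩
  | succ l ih =>
    cases hd : d l with
    | false =>
      exact ⟨l + 1, le_rfl, fun k hk hk' => by rwa [le_antisymm hk' hk], Or.inr ⟨l, rfl, hd⟩⟩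
    | true =>
      obtain ⟨a, ha, h1, h2⟩ := ih hd
      refine ⟨a, by omega, fun k hk hk' => ?_, h2⟩
      rcases Nat.lt_or_ge l k with hlt | hge
      · rwa [show k = l + 1 by omega]
      · exact h1 k hk hge

theorem exists_run_end (l m : ℕ) (hlm : l < m) (h : d l = true) :
    ∃ c, l < c ∧ c ≤ m ∧ (∀ k, l ≤ k → k < c → d k = true) ∧ (c = m ∨ d c = false) := by
  induction m, hlm using Nat.le_induction with
  | base => exact ⟨l + 1, by omega, le_rfl, fun k hk hk' => by rwa [show k = l by omega], Or.inl rfl⟩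
  | succ m hlm ih =>
    obtain ⟨c, hc, hcm, h1, h2⟩ := ih
    by_cases hd : d c = false
    · exact ⟨c, hc, by omega, h1, Or.inr hd⟩
    · obtain rfl : c = m := by tauto
      refine ⟨c + 1, by omega, le_rfl, fun k hk hk' => ?_, Or.inl rfl⟩
      rcases Nat.lt_or_ge k c with hlt | hge
      · exact h1 k hk hlt
      · rw [show k = c by omega]; simpa using hd

theorem exists_of_up {n τ : ℤ} {m l : ℕ} (hn : n = m + 1) (hl : (l : ℤ) = m - τ) (hτ : 0 < τ)
    (hper : ∀ i, H (i + n) = H i) (hanti : StrictAntiOn H (Set.Icc (τ - n) 0))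
    (hmono : StrictMonoOn H (Set.Icc 0 τ))
    (hne : ∀ i j, τ - n < i → i < 0 → 0 < j → j < τ → H i ≠ H j) (hd : d l = true) :
    ∃ i x, Reach d H m i x := by
  have htop : H (τ - n) = H τ := by rw [← hper (τ - n), sub_add_cancel]
  obtain ⟨a, hal, hrun, ha⟩ := exists_run_start l hd
  obtain ⟨c, hlc, hcm, hrun', hc⟩ := exists_run_end l m (by omega) hd
  have hinit : Reach d H a (-a) 0 := by
    rcases ha with rfl | ⟨a', rfl, ha'⟩
    · simpa using Reach.base (d := d) (H := H) 0
    · obtain ⟨x, hx, hr⟩ := exists_of_strictAntiOn (d := d) hanti a' (-(a' + 1 : ℕ)) (by omega)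
        (by push_cast; omega)
      rw [Set.mem_Icc] at hx
      have := hr.right (by
        simp only [Moves, ha']
        exact hanti (by constructor <;> omega) (by constructor <;> omega) (by omega))
      convert this using 1
      push_cast
      ring
  have hmid : Reach d H c (τ - n) (τ - n) := by
    refine sweep (J := c + (τ - n)) hanti hmono htop (by omega) (by ring) hne (c - a) a (-a) 0 hinit
      (by omega) (by omega) (by omega) (by omega) (by omega) ?_ ?_ ?_
    · exact hanti (by constructor <;> omega) (by constructor <;> omega) (by omega)
    · intro _
      exact hmono (by constructor <;> omega) (by constructor <;> omega) (by omega)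
    · intro k hk hk'
      rcases Nat.lt_or_ge k l with h | h
      · exact hrun k hk h.le
      · exact hrun' k h hk'
  rcases hc with rfl | hc
  · exact ⟨_, _, hmid⟩
  · refine complete hn hper hmono (m - c) c _ _ hmid (by omega) (by omega) (by omega) ?_
    intro z hz hz'
    simp only [Moves, hc, htop]
    exact hmono (by constructor <;> omega) (by constructor <;> omega) (by omega)

theorem exists_of_unimodal {n τ : ℤ} {m : ℕ} (hn : n = m + 1) (hτ : 0 < τ) (hτn : τ < n)
    (hper : ∀ i, H (i + n) = H i) (hanti : StrictAntiOn H (Set.Icc (τ - n) 0))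
    (hmono : StrictMonoOn H (Set.Icc 0 τ))
    (hne : ∀ i j, τ - n < i → i < 0 → 0 < j → j < τ → H i ≠ H j) :
    ∃ i x, Reach d H m i x := by
  obtain ⟨l, hl⟩ : ∃ l : ℕ, (l : ℤ) = m - τ := ⟨(m - τ).toNat, by omega⟩
  cases hd : d l with
  | true => exact exists_of_up hn hl hτ hper hanti hmono hne hd
  | false =>
    have hshift : ∀ i, H (τ - i) = H (τ - n - i) := fun i => by
      rw [← hper (τ - n - i)]; ring_nf
    obtain ⟨i, x, h⟩ := exists_of_up (d := fun k => !d k) (H := fun i => -H (τ - i)) hn hl hτ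
      (fun i => by rw [hshift i]; ring_nf)
      (fun i hi j hj hij => by
        rw [Set.mem_Icc] at hi hj
        simp only [hshift, neg_lt_neg_iff]
        exact hanti (by constructor <;> omega) (by constructor <;> omega) (by omega))
      (fun i hi j hj hij => by
        rw [Set.mem_Icc] at hi hj
        simp only [neg_lt_neg_iff]
        exact hmono (by constructor <;> omega) (by constructor <;> omega) (by omega))
      (fun i j hi hi' hj hj' h => by
        simp only [neg_inj] at h
        rw [hshift i] at h
        exact hne (τ - n - i) (τ - j) (by omega) (by omega) (by omega) (by omega) h)
      (by simp [hd])
    exact ⟨_, _, h.reflect⟩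

end Reach

theorem cross_rotate (a b c : ℝ × ℝ) : cross a b c = cross b c a := by
  simp only [cross]; ring

theorem cross_smul_add {a p q : ℝ × ℝ} (x y : ℝ × ℝ) (u v : ℝ) (huv : u + v = 1) :
    p = u • x + v • y → cross a q p = u * cross a q x + v * cross a q y := by
  rintro rfl
  obtain rfl : u = 1 - v := by linarith
  simp only [cross, Prod.fst_add, Prod.snd_add, Prod.smul_fst, Prod.smul_snd, smul_eq_mul]
  ring

theorem cross_eq_zero_of_mem_segment {a b p : ℝ × ℝ} (h : p ∈ segment ℝ a b) :
    cross a b p = 0 := by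
  obtain ⟨u, v, _, _, huv, rfl⟩ := h
  rw [cross_smul_add a b u v huv rfl]
  simp only [cross]; ring

theorem segment_inter_eq_empty {a b c d : ℝ × ℝ} (hc : 0 < cross a b c) (hd : 0 < cross a b d) :
    segment ℝ a b ∩ segment ℝ c d = ∅ := by
  rw [Set.eq_empty_iff_forall_notMem]
  rintro p ⟨hp, u, v, hu, hv, huv, hp'⟩
  have h := cross_eq_zero_of_mem_segment hp
  rw [cross_smul_add c d u v huv hp'.symm] at h
  rcases hu.eq_or_lt with rfl | hu
  · obtain rfl : v = 1 := by linarith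
    linarith
  · nlinarith [mul_pos hu hc, mul_nonneg hv hd.le]

theorem segment_inter_eq_singleton {a b c : ℝ × ℝ} (h : cross a b c ≠ 0) :
    segment ℝ a b ∩ segment ℝ b c = {b} := by
  ext p
  simp only [Set.mem_inter_iff, Set.mem_singleton_iff]
  constructor
  · rintro ⟨hp, u, v, hu, hv, huv, hp'⟩
    have h0 := cross_eq_zero_of_mem_segment hp
    rw [cross_smul_add b c u v huv hp'.symm] at h0
    have hb : cross a b b = 0 := by simp only [cross]; ring
    rw [hb, mul_zero, zero_add] at h0
    have hv0 : v = 0 := (mul_eq_zero.1 h0).resolve_right h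
    obtain rfl : u = 1 := by linarith
    rw [← hp', hv0]; simp
  · rintro rfl
    exact ⟨right_mem_segment ℝ a p, left_mem_segment ℝ p c⟩

theorem collinear_of_cross_eq_zero {a b c : ℝ × ℝ} (hab : a.2 ≠ b.2) (h : cross a b c = 0) :
    Collinear ℝ ({a, b, c} : Set (ℝ × ℝ)) := by
  rw [collinear_iff_of_mem (p₀ := a) (by simp)]
  refine ⟨b - a, ?_⟩
  have hne : b.2 - a.2 ≠ 0 := sub_ne_zero.2 hab.symm
  simp only [cross] at h
  rintro p (rfl | rfl | rfl)
  · exact ⟨0, by simp⟩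
  · exact ⟨1, by simp⟩
  · refine ⟨(p.2 - a.2) / (b.2 - a.2), ?_⟩
    ext
    · simp only [vadd_eq_add, Prod.fst_add, Prod.smul_fst, Prod.fst_sub, smul_eq_mul]
      field_simp
      linarith
    · simp only [vadd_eq_add, Prod.snd_add, Prod.smul_snd, Prod.snd_sub, smul_eq_mul]
      field_simp
      ring

theorem mem_convexHull_of_cross_nonneg {s : Set (ℝ × ℝ)} {a b c p : ℝ × ℝ} (ha : a ∈ s)
    (hb : b ∈ s) (hc : c ∈ s) (habc : 0 < cross a b c) (hab : 0 ≤ cross a b p)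
    (hbc : 0 ≤ cross b c p) (hca : 0 ≤ cross c a p) : p ∈ convexHull ℝ s := by
  have hsum : cross b c p + cross c a p + cross a b p = cross a b c := by
    simp only [cross]; ring
  have key := (convex_convexHull ℝ s).sum_mem (t := Finset.univ)
    (w := ![cross b c p / cross a b c, cross c a p / cross a b c, cross a b p / cross a b c])
    (z := ![a, b, c])
    (by intro i _; fin_cases i <;> simp <;> positivity)
    (by
      simp only [Fin.sum_univ_three, Matrix.cons_val]
      rw [← add_div, ← add_div, hsum, div_self habc.ne'])
    (by
      intro i _
      fin_cases i
      · exact subset_convexHull ℝ s ha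
      · exact subset_convexHull ℝ s hb
      · exact subset_convexHull ℝ s hc)
  convert key using 1
  simp only [Fin.sum_univ_three, Matrix.cons_val]
  have hne := habc.ne'
  ext
  · simp only [Prod.fst_add, Prod.smul_fst, smul_eq_mul]
    field_simp
    simp only [cross]; ring
  · simp only [Prod.snd_add, Prod.smul_snd, smul_eq_mul]
    field_simp
    simp only [cross]; ring

/-- The heights of a counterclockwise convex quadrilateral do not alternate. -/
theorem false_of_alternating {a b c d : ℝ × ℝ} (habc : 0 < cross a b c) (hbcd : 0 < cross b c d)
    (hcda : 0 < cross c d a) (hdab : 0 < cross d a b) (h1 : a.2 < b.2) (h2 : c.2 < b.2)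
    (h3 : c.2 < d.2) (h4 : a.2 < d.2) : False := by
  have e1 : (b.2 - a.2) * cross b c d + (d.2 - c.2) * cross a b c =
      (b.2 - c.2) * ((d.1 - c.1) * (b.2 - a.2) - (d.2 - c.2) * (b.1 - a.1)) := by
    simp only [cross]; ring
  have e2 : (b.2 - a.2) * cross c d a + (d.2 - c.2) * cross d a b =
      (d.2 - a.2) * ((b.1 - a.1) * (d.2 - c.2) - (b.2 - a.2) * (d.1 - c.1)) := by
    simp only [cross]; ring
  have p1 : 0 < (b.2 - a.2) * cross b c d + (d.2 - c.2) * cross a b c :=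
    add_pos (mul_pos (sub_pos.2 h1) hbcd) (mul_pos (sub_pos.2 h3) habc)
  have p2 : 0 < (b.2 - a.2) * cross c d a + (d.2 - c.2) * cross d a b :=
    add_pos (mul_pos (sub_pos.2 h1) hcda) (mul_pos (sub_pos.2 h3) hdab)
  rw [e1] at p1
  rw [e2] at p2
  have q1 := (mul_pos_iff_of_pos_left (sub_pos.2 h2)).1 p1
  have q2 := (mul_pos_iff_of_pos_left (sub_pos.2 h4)).1 p2
  linarith

theorem Finset.exists_enumeration {α K : Type*} [Inhabited α] [LinearOrder K] (T : Finset α)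
    (κ : α → K) (hκ : Set.InjOn κ T) :
    ∃ f : ℕ → α, (∀ i < T.card, f i ∈ T) ∧ (∀ i j, i < j → j < T.card → κ (f i) < κ (f j)) ∧
      ∀ x ∈ T, ∃ i < T.card, f i = x := by
  classical
  have hcard : (T.image κ).card = T.card := Finset.card_image_of_injOn hκ
  let e := (T.image κ).orderEmbOfFin hcard
  have he : ∀ i, ∃ x ∈ T, κ x = e i := fun i =>
    Finset.mem_image.1 (Finset.orderEmbOfFin_mem _ hcard i)
  choose g hg hge using he
  refine ⟨fun i => if h : i < T.card then g ⟨i, h⟩ else default, ?_, ?_, ?_⟩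
  · intro i hi
    simpa [hi] using hg ⟨i, hi⟩
  · intro i j hij hj
    simp only [hij.trans hj, hj, dif_pos, hge]
    exact e.strictMono hij
  · intro x hx
    have : κ x ∈ Set.range e := by
      rw [Finset.range_orderEmbOfFin]
      exact Finset.mem_coe.2 (Finset.mem_image_of_mem κ hx)
    obtain ⟨i, hi⟩ := this
    refine ⟨i, i.2, ?_⟩
    simp only [i.2, dif_pos]
    exact hκ (hg i) hx ((hge i).trans hi)

theorem cross_ne_zero_of_genPos {S : Set (ℝ × ℝ)} (hgen : GenPos S) {a b c : ℝ × ℝ} (ha : a ∈ S)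
    (hb : b ∈ S) (hc : c ∈ S) (hab : a ≠ b) (hac : a ≠ c) (hbc : b ≠ c) : cross a b c ≠ 0 :=
  fun h => hgen.1 a ha b hb c hc hab hac hbc
    (collinear_of_cross_eq_zero (hgen.2 a ha b hb hab).2 h)

/-- A convex point set, enumerated counterclockwise starting from its bottommost point. -/
theorem exists_ccw_enumeration {S : Set (ℝ × ℝ)} {n : ℕ} (hfin : S.Finite) (hcard : S.ncard = n)
    (hconv : ConvexPos S) (hgen : GenPos S) {b : ℝ × ℝ} (hb : IsBottommost S b) :
    ∃ f : ℕ → ℝ × ℝ, (∀ i < n, f i ∈ S) ∧ (∀ x ∈ S, ∃ i < n, f i = x) ∧ f 0 = b ∧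
      ∀ i j k, i < j → j < k → k < n → 0 < cross (f i) (f j) (f k) := by
  classical
  let κ : ℝ × ℝ → WithBot ℝ := fun p =>
    if p = b then ⊥ else ((-(p.1 - b.1) / (p.2 - b.2) : ℝ) : WithBot ℝ)
  have hκ : ∀ p ∈ S, ∀ q ∈ S, p ≠ b → q ≠ b → (κ p < κ q ↔ 0 < cross b p q) := by
    intro p hp q hq hpb hqb
    have h1 := sub_pos.2 (hb.2 p hp hpb)
    have h2 := sub_pos.2 (hb.2 q hq hqb)
    simp only [κ, hpb, hqb, if_false, WithBot.coe_lt_coe]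
    rw [div_lt_div_iff₀ h1 h2, cross, ← sub_pos]
    constructor <;> intro h <;> linarith
  have hcr : ∀ p ∈ S, ∀ q ∈ S, p ≠ b → q ≠ b → p ≠ q → cross b p q ≠ 0 :=
    fun p hp q hq hpb hqb hpq =>
      cross_ne_zero_of_genPos hgen hb.1 hp hq hpb.symm hqb.symm hpq
  have hinj : Set.InjOn κ (hfin.toFinset : Set (ℝ × ℝ)) := by
    intro p hp q hq h
    rw [Set.Finite.coe_toFinset] at hp hq
    by_contra hpq
    by_cases hpb : p = b
    · by_cases hqb : q = b
      · exact hpq (hpb.trans hqb.symm)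
      · simp [κ, hpb, hqb] at h
    · by_cases hqb : q = b
      · simp [κ, hpb, hqb] at h
      · have h1 := (hκ p hp q hq hpb hqb).not.1 h.not_lt
        have h2 := (hκ q hq p hp hqb hpb).not.1 h.not_gt
        have h3 : cross b q p = -cross b p q := by simp only [cross]; ring
        exact hcr p hp q hq hpb hqb hpq (by linarith)
  obtain ⟨f, hfS, hlt, hsurj⟩ := hfin.toFinset.exists_enumeration κ hinj
  rw [← Set.ncard_eq_toFinset_card S hfin, hcard] at hfS hlt hsurj
  simp only [Set.Finite.mem_toFinset] at hfS hsurj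
  have hf0 : f 0 = b := by
    obtain ⟨i, hi, hib⟩ := hsurj b hb.1
    rcases Nat.eq_zero_or_pos i with rfl | hpos
    · exact hib
    · have := hlt 0 i hpos hi
      rw [hib] at this
      simp [κ] at this
  have hfne : ∀ i j, i < j → j < n → f i ≠ f j := fun i j hij hj h =>
    (hlt i j hij hj).ne (congrArg κ h)
  have hfb : ∀ i, 0 < i → i < n → f i ≠ b := fun i h0 hi h => hfne 0 i h0 hi (hf0.trans h.symm)
  have hbase : ∀ i j, 0 < i → i < j → j < n → 0 < cross b (f i) (f j) := fun i j h0 hij hj =>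
    (hκ _ (hfS i (by omega)) _ (hfS j hj) (hfb i h0 (by omega)) (hfb j (by omega) hj)).1
      (hlt i j hij hj)
  refine ⟨f, hfS, hsurj, hf0, ?_⟩
  intro i j k hij hjk hk
  rcases Nat.eq_zero_or_pos i with rfl | hi
  · rw [hf0]; exact hbase j k hij hjk hk
  · by_contra hneg
    have hle := not_lt.1 hneg
    have hj := hfS j (by omega)
    refine (convexIndependent_set_iff_notMem_convexHull_sdiff.1 hconv) (f j) hj ?_
    refine mem_convexHull_of_cross_nonneg (a := b) (b := f i) (c := f k)
      ⟨hb.1, (hfb j (by omega) (by omega)).symm⟩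
      ⟨hfS i (by omega), hfne i j hij (by omega)⟩ ⟨hfS k hk, (hfne j k hjk hk).symm⟩
      (hbase i k hi (by omega) hk) (hbase i j hi hij (by omega)).le ?_ ?_
    · have : cross (f i) (f k) (f j) = -cross (f i) (f j) (f k) := by simp only [cross]; ring
      linarith
    · rw [cross_rotate]; exact (hbase j k (by omega) hjk hk).le

theorem exists_isBottommost {S : Set (ℝ × ℝ)} (hfin : S.Finite) (hne : S.Nonempty)
    (hgen : GenPos S) : ∃ b, IsBottommost S b := by
  obtain ⟨b, hb, hmin⟩ := Set.exists_min_image S Prod.snd hfin hne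
  exact ⟨b, hb, fun p hp hpb => lt_of_le_of_ne (hmin p hp) (hgen.2 p hp b hb hpb).2.symm⟩

theorem exists_isTopmost {S : Set (ℝ × ℝ)} (hfin : S.Finite) (hne : S.Nonempty)
    (hgen : GenPos S) : ∃ t, IsTopmost S t := by
  obtain ⟨t, ht, hmax⟩ := Set.exists_max_image S Prod.snd hfin hne
  exact ⟨t, ht, fun p hp hpt => lt_of_le_of_ne (hmax p hp) (hgen.2 p hp t ht hpt).2⟩

/-- A convex point set as a periodic counterclockwise sequence with unimodal heights. -/
theorem exists_periodic_enumeration {S : Set (ℝ × ℝ)} {m : ℕ} (hfin : S.Finite)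
    (hcard : S.ncard = m + 1) (hm : 0 < m) (hconv : ConvexPos S) (hgen : GenPos S) :
    ∃ (P : ℤ → ℝ × ℝ) (τ : ℤ), 0 < τ ∧ τ < m + 1 ∧ (∀ i, P i ∈ S) ∧
      (∀ i, P (i + (m + 1)) = P i) ∧
      (∀ i j k : ℤ, i < j → j < k → k < i + (m + 1) → 0 < cross (P i) (P j) (P k)) ∧
      (∀ i j : ℤ, i < j → j < i + (m + 1) → P i ≠ P j) ∧
      StrictMonoOn (fun i => (P i).2) (Set.Icc 0 τ) ∧
      StrictAntiOn (fun i => (P i).2) (Set.Icc (τ - (m + 1)) 0) := by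
  have hne : S.Nonempty := Set.nonempty_of_ncard_ne_zero (by omega)
  obtain ⟨b, hb⟩ := exists_isBottommost hfin hne hgen
  obtain ⟨t, ht⟩ := exists_isTopmost hfin hne hgen
  obtain ⟨f, hfS, hsurj, hf0, hccw⟩ := exists_ccw_enumeration hfin hcard hconv hgen hb
  have hfne : ∀ i j, i < j → j < m + 1 → f i ≠ f j := by
    have hinj : Set.InjOn f (Finset.range (m + 1) : Set ℕ) := by
      refine Finset.injOn_of_surjOn_of_card_le (t := hfin.toFinset) f ?_ ?_ ?_
      · intro i hi; simpa using hfS i (by simpa using hi)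
      · intro x hx
        obtain ⟨i, hi, rfl⟩ := hsurj x (by simpa using hx)
        exact ⟨i, by simpa using hi, rfl⟩
      · rw [← Set.ncard_eq_toFinset_card S hfin, hcard]; simp
    intro i j hij hj h
    have := hinj (by simp; omega) (by simp; omega) h
    omega
  obtain ⟨T, hT, rfl⟩ := hsurj t ht.1
  subst hf0
  have hT0 : 0 < T := by
    by_contra h
    obtain rfl : T = 0 := by omega
    have h1 := fun h => hb.2 (f 1) (hfS 1 (by omega)) h
    have h2 := fun h => ht.2 (f 1) (hfS 1 (by omega)) h
    have h3 := (hfne 0 1 (by omega) (by omega)).symm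
    exact lt_asymm (h1 h3) (h2 h3)
  have hbot : ∀ i, 0 < i → i < m + 1 → (f 0).2 < (f i).2 := fun i hi him =>
    hb.2 _ (hfS i him) (hfne 0 i hi him).symm
  have htop : ∀ i, i ≠ T → i < m + 1 → (f i).2 < (f T).2 := fun i hi him =>
    ht.2 _ (hfS i him) (by
      rcases lt_or_gt_of_ne hi with h | h
      · exact hfne i T h hT
      · exact (hfne T i h him).symm)
  have hup : ∀ i j, i < j → j ≤ T → (f i).2 < (f j).2 := by
    intro i j hij hj
    rcases hj.eq_or_lt with rfl | hj
    · exact htop i (by omega) (by omega)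
    rcases Nat.eq_zero_or_pos i with rfl | hi
    · exact hbot j hij (by omega)
    by_contra hneg
    have hlt := lt_of_le_of_ne (not_lt.1 hneg)
      (hgen.2 _ (hfS j (by omega)) _ (hfS i (by omega)) (hfne i j hij (by omega)).symm).2
    exact false_of_alternating (hccw 0 i j hi hij (by omega)) (hccw i j T hij hj hT)
      (by rw [← cross_rotate]; exact hccw 0 j T (by omega) hj hT)
      (by rw [cross_rotate]; exact hccw 0 i T hi (by omega) hT)
      (hbot i hi (by omega)) hlt (htop j (by omega) (by omega)) (hbot T hT0 hT)
  have hdown : ∀ i j, T ≤ i → i < j → j < m + 1 → (f j).2 < (f i).2 := by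
    intro i j hi hij hj
    rcases hi.eq_or_lt with rfl | hi
    · exact htop j (by omega) (by omega)
    by_contra hneg
    have hlt := lt_of_le_of_ne (not_lt.1 hneg)
      (hgen.2 _ (hfS i (by omega)) _ (hfS j (by omega)) (hfne i j hij (by omega))).2
    exact false_of_alternating (hccw 0 T i hT0 hi (by omega)) (hccw T i j hi hij hj)
      (by rw [← cross_rotate]; exact hccw 0 i j (by omega) hij hj)
      (by rw [cross_rotate]; exact hccw 0 T j hT0 (by omega) hj)
      (hbot T hT0 hT) (htop i (by omega) (by omega)) hlt (hbot j (by omega) hj)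
  have hmod : ∀ i : ℤ, (i % (m + 1 : ℤ)).toNat < m + 1 := fun i => by
    have := Int.emod_nonneg i (show (m + 1 : ℤ) ≠ 0 by omega)
    have := Int.emod_lt_of_pos i (show (0 : ℤ) < m + 1 by omega)
    omega
  have hP : ∃ P : ℤ → ℝ × ℝ, (∀ i, P i ∈ S) ∧ (∀ i, P (i + (m + 1)) = P i) ∧
      ∀ i : ℕ, i < m + 1 → P i = f i := by
    refine ⟨fun i => f (i % (m + 1 : ℤ)).toNat, fun i => hfS _ (hmod i), fun i => by simp,
      fun i hi => ?_⟩
    simp only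
    rw [Int.emod_eq_of_lt (by omega) (by omega), Int.toNat_natCast]
  obtain ⟨P, hPS, hper, hPf⟩ := hP
  have hper' : ∀ i (a : ℤ), P (i + a * (m + 1)) = P i := fun i a =>
    (show Function.Periodic P ((m : ℤ) + 1) from hper).int_mul a i
  have hccwP : ∀ i j k : ℤ, 0 ≤ i → i < j → j < k → k < m + 1 →
      0 < cross (P i) (P j) (P k) := by
    intro i j k hi hij hjk hk
    lift i to ℕ using hi
    lift j to ℕ using by omega
    lift k to ℕ using by omega
    rw [hPf i (by omega), hPf j (by omega), hPf k (by omega)]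
    exact hccw i j k (by omega) (by omega) (by omega)
  have hneP : ∀ i j : ℤ, 0 ≤ i → i < j → j < m + 1 → P i ≠ P j := by
    intro i j hi hij hj
    lift i to ℕ using hi
    lift j to ℕ using by omega
    rw [hPf i (by omega), hPf j (by omega)]
    exact hfne i j (by omega) (by omega)
  have hback : ∀ i : ℤ, P (i - (m + 1)) = P i := fun i => by
    rw [← hper (i - (m + 1)), sub_add_cancel]
  have hquot : ∀ i : ℤ, ∃ a : ℤ, 0 ≤ i + a * (m + 1) ∧ i + a * (m + 1) < m + 1 := fun i =>
    ⟨-(i / (m + 1)), by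
      have h1 := Int.emod_nonneg i (show (m + 1 : ℤ) ≠ 0 by omega)
      have h2 := Int.emod_lt_of_pos i (show (0 : ℤ) < m + 1 by omega)
      have h3 := Int.emod_add_mul_ediv i (m + 1)
      constructor <;> linarith⟩
  refine ⟨P, T, by omega, by omega, hPS, hper, ?_, ?_, ?_, ?_⟩
  · intro i j k hij hjk hki
    obtain ⟨a, ha, ha'⟩ := hquot i
    rw [← hper' i a, ← hper' j a, ← hper' k a]
    generalize a * ((m : ℤ) + 1) = w at *
    rcases lt_or_ge (k + w) (m + 1) with hk | hk
    · exact hccwP _ _ _ ha (by omega) (by omega) hk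
    rcases lt_or_ge (j + w) (m + 1) with hj | hj
    · rw [← hback (k + w), ← cross_rotate]
      exact hccwP _ _ _ (by omega) (by omega) (by omega) hj
    · rw [← hback (k + w), ← hback (j + w), cross_rotate]
      exact hccwP _ _ _ (by omega) (by omega) (by omega) (by omega)
  · intro i j hij hji
    obtain ⟨a, ha, ha'⟩ := hquot i
    rw [← hper' i a, ← hper' j a]
    generalize a * ((m : ℤ) + 1) = w at *
    rcases lt_or_ge (j + w) (m + 1) with hj | hj
    · exact hneP _ _ ha (by omega) hj
    · rw [← hback (j + w)]
      exact (hneP _ _ (by omega) (by omega) ha').symm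
  · intro i hi j hj hij
    rw [Set.mem_Icc] at hi hj
    lift i to ℕ using hi.1
    lift j to ℕ using hj.1
    simp only
    rw [hPf i (by omega), hPf j (by omega)]
    exact hup i j (by omega) (by omega)
  · intro i hi j hj hij
    rw [Set.mem_Icc] at hi hj
    simp only
    obtain ⟨i', hi'⟩ : ∃ i' : ℕ, (i' : ℤ) = i + (m + 1) := ⟨(i + (m + 1)).toNat, by omega⟩
    rw [← hper i, ← hi', hPf i' (by omega)]
    rcases hj.2.eq_or_lt with rfl | hj0
    · have h0 := hPf 0 (by omega)
      push_cast at h0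
      rw [h0]
      exact hbot i' (by omega) (by omega)
    · obtain ⟨j', hj'⟩ : ∃ j' : ℕ, (j' : ℤ) = j + (m + 1) := ⟨(j + (m + 1)).toNat, by omega⟩
      rw [← hper j, ← hj', hPf j' (by omega)]
      exact hdown i' j' (by omega) (by omega) (by omega)

theorem segment_inter_eq_empty_of_arcs {P : ℤ → ℝ × ℝ} {n lo hi p q r s : ℤ}
    (hper : ∀ i, P (i + n) = P i)
    (hccw : ∀ i j k, i < j → j < k → k < i + n → 0 < cross (P i) (P j) (P k))
    (hp : p ∈ Set.Icc lo hi) (hq : q ∈ Set.Icc lo hi) (hpq : p ≠ q)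
    (hr : r ∉ Set.Icc lo hi) (hs : s ∉ Set.Icc lo hi)
    (hr1 : hi < r + n) (hr2 : r < lo + n) (hs1 : hi < s + n) (hs2 : s < lo + n) :
    segment ℝ (P p) (P q) ∩ segment ℝ (P r) (P s) = ∅ := by
  have shift : ∀ r, r ∉ Set.Icc lo hi → hi < r + n → r < lo + n →
      ∃ r', hi < r' ∧ r' < lo + n ∧ P r' = P r := by
    intro r hr h1 h2
    rw [Set.mem_Icc] at hr
    rcases lt_or_ge r lo with h | h
    · exact ⟨r + n, h1, by omega, hper r⟩
    · exact ⟨r, by omega, h2, rfl⟩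
  obtain ⟨r', hr1, hr2, hr'⟩ := shift r hr hr1 hr2
  obtain ⟨s', hs1, hs2, hs'⟩ := shift s hs hs1 hs2
  rw [← hr', ← hs']
  rw [Set.mem_Icc] at hp hq
  rcases lt_or_gt_of_ne hpq with h | h
  · exact segment_inter_eq_empty (hccw p q r' h (by omega) (by omega))
      (hccw p q s' h (by omega) (by omega))
  · rw [segment_symm]
    exact segment_inter_eq_empty (hccw q p r' h (by omega) (by omega))
      (hccw q p s' h (by omega) (by omega))

/-- every {U,D}-path admits a PDCE on every convex point set in general
position. -/
theorem UD_pdce {m : ℕ} (d : Fin m → Dir)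
    (hd : ∀ i, d i = Dir.U ∨ d i = Dir.D) (S : Set (ℝ × ℝ)) (hfin : S.Finite)
    (hcard : S.ncard = m + 1) (hconv : ConvexPos S) (hgen : GenPos S) :
    ∃ E : Fin (m + 1) → ℝ × ℝ, PDCE d E S := by
  rcases Nat.eq_zero_or_pos m with rfl | hm
  · obtain ⟨p, rfl⟩ := Set.ncard_eq_one.1 hcard
    refine ⟨fun _ => p, ⟨fun i j _ => Fin.ext (by omega), by simp⟩, fun i => i.elim0,
      fun i => i.elim0, fun i => i.elim0⟩
  obtain ⟨P, τ, hτ, hτm, hPS, hper, hccw, hPne, hmono, hanti⟩ :=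
    exists_periodic_enumeration hfin hcard hm hconv hgen
  let d' : ℕ → Bool := fun k => if h : k < m then d ⟨k, h⟩ = Dir.U else true
  have hPmod : ∀ i j : ℤ, τ - (m + 1) < i → i < 0 → 0 < j → j < τ → (P i).2 ≠ (P j).2 :=
    fun i j h1 h2 h3 h4 =>
      (hgen.2 _ (hPS i) _ (hPS j) (hPne i j (by omega) (by omega))).2
  obtain ⟨i₀, x₀, hreach⟩ := Reach.exists_of_unimodal (d := d') (H := fun i => (P i).2)
    (n := (m : ℤ) + 1) rfl hτ hτm (fun i => by simp only [hper]) hanti hmono hPmod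
  obtain ⟨σ, lo, -, -, harc, hmov⟩ := hreach.exists_sequence
  have hσinj : Set.InjOn σ (Finset.range (m + 1) : Set ℕ) := by
    refine Finset.injOn_of_surjOn_of_card_le (t := Finset.Icc (lo m) (lo m + m)) σ ?_ ?_ ?_
    · intro i hi
      simp only [Finset.coe_range, Set.mem_Iio] at hi
      simpa using (harc m le_rfl (σ i)).2 ⟨i, by omega, rfl⟩
    · intro z hz
      obtain ⟨j, hj, rfl⟩ := (harc m le_rfl z).1 (by simpa using hz)
      exact ⟨j, by simp; omega, rfl⟩
    · simp; omega
  have hσm : ∀ i ≤ m, lo m ≤ σ i ∧ σ i ≤ lo m + m := fun i hi =>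
    (harc m le_rfl (σ i)).2 ⟨i, hi, rfl⟩
  have hσne : ∀ i j, i ≤ m → j ≤ m → i ≠ j → σ i ≠ σ j := fun i j hi hj hij h =>
    hij (hσinj (by simp; omega) (by simp; omega) h)
  have hE : ∀ i j, i ≤ m → j ≤ m → i ≠ j → P (σ i) ≠ P (σ j) := by
    intro i j hi hj hij
    have h1 := hσm i hi
    have h2 := hσm j hj
    rcases lt_or_gt_of_ne (hσne i j hi hj hij) with h | h
    · exact hPne _ _ h (by omega)
    · exact (hPne _ _ h (by omega)).symm
  have hEinj : Function.Injective fun i : Fin (m + 1) => P (σ i) := fun i j h => by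
    by_contra hij
    exact hE i j (by omega) (by omega) (fun h' => hij (Fin.ext h')) h
  refine ⟨fun i => P (σ i), ⟨hEinj, ?_⟩, ?_, ?_, ?_⟩
  · refine Set.eq_of_subset_of_ncard_le ?_ ?_ hfin
    · rintro _ ⟨i, rfl⟩; exact hPS _
    · rw [hcard, ← Set.image_univ, Set.ncard_image_of_injective _ hEinj]; simp
  · intro i
    have h := hmov i i.2
    rcases hd i with hi | hi <;> simpa [d', hi, Moves, dirOk] using h
  · intro i j hij
    have hj := j.2
    have hin : ∀ l ≤ (i : ℕ) + 1, σ l ∈ Set.Icc (lo (i + 1)) (lo (i + 1) + (i + 1 : ℕ)) :=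
      fun l hl => (harc (i + 1) (by omega) _).2 ⟨l, hl, rfl⟩
    have hout : ∀ l, (i : ℕ) + 1 < l → l ≤ m →
        σ l ∉ Set.Icc (lo (i + 1)) (lo (i + 1) + (i + 1 : ℕ)) := by
      intro l hl hlm h
      obtain ⟨l', hl', h'⟩ := (harc (i + 1) (by omega) _).1 h
      exact hσne l' l (by omega) hlm (by omega) h'
    have hlo : lo m ≤ lo (i + 1) ∧ lo (i + 1) + (i + 1 : ℕ) ≤ lo m + m := by
      obtain ⟨l, hl, h⟩ := (harc (i + 1) (by omega) (lo (i + 1))).1 (by constructor <;> omega)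
      obtain ⟨l', hl', h'⟩ := (harc (i + 1) (by omega) (lo (i + 1) + (i + 1 : ℕ))).1
        (by constructor <;> omega)
      have h1 := hσm l (by omega)
      have h2 := hσm l' (by omega)
      omega
    have h1 := hσm j (by omega)
    have h2 := hσm (j + 1) (by omega)
    exact segment_inter_eq_empty_of_arcs hper hccw (p := σ i) (q := σ (i + 1))
      (r := σ j) (s := σ (j + 1)) (hin i (by omega)) (hin (i + 1) le_rfl)
      (hσne _ _ (by omega) (by omega) (by omega)) (hout j (by omega) (by omega))
      (hout (j + 1) (by omega) (by omega)) (by omega) (by omega) (by omega) (by omega)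
  · intro i j hij
    have hj := j.2
    have he : j.castSucc = i.succ := Fin.ext (by simp; omega)
    rw [he]
    exact segment_inter_eq_singleton (cross_ne_zero_of_genPos hgen (hPS _) (hPS _) (hPS _)
      (hE i (i + 1) (by omega) (by omega) (by omega)) (hE i (j + 1) (by omega) (by omega) (by omega))
      (hE (i + 1) (j + 1) (by omega) (by omega) (by omega)))
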